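/- For the two-parameter Hahn spin chain, the end-to-end correlation function equals f_{2m+1,0}(t) = -i(-1)^m √((β)_{m+1}(α+1)_{m+1}) · Σ_{j=0}^{m} ((2j+α+β+1)(-m)_j)/((j+α+β+1)_{m+1} j!) · sin(2t√((α+j+1)(β+j)))/√((α+j+1)(β+j)). -/

import Mathlib

open Finset Matrix

/-- Pochhammer symbol `(a)_k = a(a+1)⋯(a+k-1)`. -/
noncomputable def poch (a : ℝ) (k : ℕ) : ℝ := ∏ i ∈ Finset.range k, (a + i)

/-- The Hahn polynomial `Q_n(x;α,β,m)` as a terminating ₃F₂ series. -/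
noncomputable def hahnQ (n : ℕ) (x α β : ℝ) (m : ℕ) : ℝ :=
  ∑ k ∈ Finset.range (n + 1),
    poch (-(n : ℝ)) k * poch ((n : ℝ) + α + β + 1) k * poch (-x) k /
      ((k.factorial : ℝ) * poch (α + 1) k * poch (-(m : ℝ)) k)

/-- The Hahn weight `w(x;α,β,m) = C(α+x,x) C(m+β-x,m-x)`. -/
noncomputable def hahnW (x : ℕ) (α β : ℝ) (m : ℕ) : ℝ :=
  (poch (α + 1) x / (x.factorial : ℝ)) * (poch (β + 1) (m - x) / ((m - x).factorial : ℝ))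

/-- The squared norm `h_n(α,β,m)` of the Hahn polynomials. -/
noncomputable def hahnH (n : ℕ) (α β : ℝ) (m : ℕ) : ℝ :=
  ((-1 : ℝ) ^ n * poch ((n : ℝ) + α + β + 1) (m + 1) * poch (β + 1) n * (n.factorial : ℝ)) /
    ((2 * (n : ℝ) + α + β + 1) * poch (α + 1) n * poch (-(m : ℝ)) n * (m.factorial : ℝ))

/-- Orthonormal Hahn function `Q̃_n(x;α,β,m)`. -/
noncomputable def hahnQt (n x : ℕ) (α β : ℝ) (m : ℕ) : ℝ :=
  Real.sqrt (hahnW x α β m) * hahnQ n (x : ℝ) α β m / Real.sqrt (hahnH n α β m)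

/-- The matrix `U` of eigenvectors, built from Hahn polynomials with
parameters `(α,β)` (even rows) and `(α+1,β-1)` (odd rows). -/
noncomputable def hahnU (α β : ℝ) (m : ℕ) : Matrix (Fin (2 * m + 2)) (Fin (2 * m + 2)) ℝ :=
  Matrix.of fun r c =>
    let i : ℕ := (r : ℕ) / 2
    let j : ℕ := if (c : ℕ) ≤ m then m - (c : ℕ) else (c : ℕ) - m - 1
    if (r : ℕ) % 2 = 0 then
      ((-1 : ℝ) ^ i / Real.sqrt 2) * hahnQt j i α β m
    else
      (if (c : ℕ) ≤ m then (-1 : ℝ) else 1) * ((-1 : ℝ) ^ i / Real.sqrt 2)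
        * hahnQt j i (α + 1) (β - 1) m

/-- The spin chain couplings `J_k`. -/
noncomputable def hahnJ (α β : ℝ) (m : ℕ) (k : ℕ) : ℝ :=
  if k % 2 = 1 then Real.sqrt (((k : ℝ) + 1) * ((2 * m + 1 : ℝ) - k))
  else Real.sqrt (((k : ℝ) + 2 * α + 2) * ((2 * m : ℝ) + 2 * β - k))

/-- The tridiagonal single-excitation interaction matrix `M`. -/
noncomputable def hahnM (α β : ℝ) (m : ℕ) : Matrix (Fin (2 * m + 2)) (Fin (2 * m + 2)) ℝ :=
  Matrix.of fun r c =>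
    if (r : ℕ) + 1 = (c : ℕ) then hahnJ α β m r
    else if (c : ℕ) + 1 = (r : ℕ) then hahnJ α β m c
    else 0

/-- The eigenvalues `ε_{m-k} = -2√((α+k+1)(β+k))`, `ε_{m+k+1} = 2√((α+k+1)(β+k))`. -/
noncomputable def hahnEps (α β : ℝ) (m : ℕ) (c : Fin (2 * m + 2)) : ℝ :=
  if (c : ℕ) ≤ m then
    -2 * Real.sqrt ((α + (m - (c : ℕ) : ℕ) + 1) * (β + (m - (c : ℕ) : ℕ)))
  else
    2 * Real.sqrt ((α + ((c : ℕ) - m - 1 : ℕ) + 1) * (β + ((c : ℕ) - m - 1 : ℕ)))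

/-- The correlation function `f_{r,s}(t)`. -/
noncomputable def hahnCorr (α β : ℝ) (m : ℕ) (r s : Fin (2 * m + 2)) (t : ℝ) : ℂ :=
  ∑ j : Fin (2 * m + 2),
    ((hahnU α β m r j * hahnU α β m s j : ℝ) : ℂ)
      * Complex.exp (-Complex.I * t * (hahnEps α β m j : ℝ))

lemma poch_zero (a : ℝ) : poch a 0 = 1 := by simp [poch]

lemma poch_succ (a : ℝ) (k : ℕ) : poch a (k + 1) = poch a k * (a + k) := by
  simp [poch, Finset.prod_range_succ]

lemma poch_succ_left (a : ℝ) (k : ℕ) : poch a (k + 1) = a * poch (a + 1) k := by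
  simp only [poch]
  rw [Finset.prod_range_succ', mul_comm]
  congr 1
  · simp
  · refine Finset.prod_congr rfl fun i _ => ?_
    push_cast; ring

lemma poch_pos {a : ℝ} (ha : 0 < a) (k : ℕ) : 0 < poch a k :=
  Finset.prod_pos fun i _ => by positivity

lemma poch_neg (n k : ℕ) :
    poch (-(n : ℝ)) k = (-1) ^ k * (n.choose k : ℝ) * (k.factorial : ℝ) := by
  induction k with
  | zero => simp [poch_zero]
  | succ k ih =>
    rw [poch_succ, ih]
    rcases le_or_gt k n with h | h
    · have h1 := Nat.choose_succ_right_eq n k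
      have h2 : (n.choose (k + 1) : ℝ) * ((k : ℝ) + 1) = (n.choose k : ℝ) * ((n : ℝ) - k) := by
        rw [← Nat.cast_sub h]; exact_mod_cast h1
      rw [Nat.factorial_succ]
      push_cast
      rw [pow_succ]
      linear_combination ((-1) ^ k * (k.factorial : ℝ)) * h2
    · rw [Nat.choose_eq_zero_of_lt h, Nat.choose_eq_zero_of_lt (by omega)]
      simp

lemma chu (n : ℕ) : ∀ b c : ℝ, 0 < c →
    ∑ k ∈ Finset.range (n + 1), (-1 : ℝ) ^ k * (n.choose k : ℝ) * (poch b k / poch c k)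
      = poch (c - b) n / poch c n := by
  induction n with
  | zero => intro b c hc; simp [poch_zero]
  | succ n ih =>
    intro b c hc
    have h1 := ih b c hc
    have h2 := ih (b + 1) (c + 1) (by linarith)
    have e : ∑ k ∈ Finset.range (n + 2), (-1 : ℝ) ^ k * ((n + 1).choose k : ℝ)
          * (poch b k / poch c k)
        = (∑ k ∈ Finset.range (n + 2), (-1 : ℝ) ^ k * (n.choose k : ℝ) * (poch b k / poch c k))
          - b / c * ∑ k ∈ Finset.range (n + 1), (-1 : ℝ) ^ k * (n.choose k : ℝ)
            * (poch (b + 1) k / poch (c + 1) k) := by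
      rw [Finset.sum_range_succ', Finset.sum_range_succ' _ (n + 1), Finset.mul_sum,
        add_sub_right_comm, ← Finset.sum_sub_distrib]
      congr 1
      · refine Finset.sum_congr rfl fun k _ => ?_
        have h3 := (poch_pos (show 0 < c + 1 by linarith) k).ne'
        rw [Nat.choose_succ_succ, poch_succ_left b, poch_succ_left c]
        push_cast
        field_simp
        ring
      · simp
    rw [e, Finset.sum_range_succ, h1, h2, Nat.choose_succ_self]
    have h3 := (poch_pos (show 0 < c + 1 by linarith) n).ne'
    have h4 := (poch_pos hc n).ne'
    have h5 : c + n ≠ 0 := by positivity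
    have h6 : poch c n * (c + n) = c * poch (c + 1) n := by
      rw [← poch_succ, poch_succ_left]
    have h7 : poch (c + 1) n = poch c n * (c + n) / c := by rw [h6]; field_simp
    rw [show c + 1 - (b + 1) = c - b by ring, poch_succ (c - b) n, poch_succ c n, h7]
    field_simp
    push_cast
    ring

lemma poch_reflect (b : ℝ) (n : ℕ) : poch (-b - n) n = (-1) ^ n * poch (b + 1) n := by
  simp only [poch]
  have hc : (-1 : ℝ) ^ n = ∏ _i ∈ Finset.range n, (-1 : ℝ) := by simp
  rw [← Finset.prod_range_reflect, hc, ← Finset.prod_mul_distrib]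
  refine Finset.prod_congr rfl fun i hi => ?_
  have hi' := Finset.mem_range.1 hi
  have : ((n - 1 - i : ℕ) : ℝ) = (n : ℝ) - 1 - i := by
    rw [Nat.cast_sub (by omega), Nat.cast_sub (by omega)]; simp
  rw [this]; ring

lemma poch_neg_ne {m j : ℕ} (h : j ≤ m) : poch (-(m : ℝ)) j ≠ 0 := by
  rw [poch_neg]
  have := (Nat.choose_pos h).ne'
  positivity

lemma hahnQ_last {m j : ℕ} (h : j ≤ m) (a b : ℝ) (ha : 0 < a + 1) :
    hahnQ j (m : ℝ) a b m = (-1) ^ j * poch (b + 1) j / poch (a + 1) j := by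
  rw [← poch_reflect, show -b - (j : ℝ) = (a + 1) - ((j : ℝ) + a + b + 1) by ring,
    ← chu j _ _ ha, hahnQ]
  refine Finset.sum_congr rfl fun k hk => ?_
  have h1 := poch_neg_ne (m := m) (j := k) (by have := Finset.mem_range.1 hk; omega)
  have h2 := (poch_pos ha k).ne'
  have h3 : (k.factorial : ℝ) ≠ 0 := by positivity
  rw [poch_neg j]
  field_simp

lemma hahnQ_zero (j m : ℕ) (a b : ℝ) : hahnQ j ((0 : ℕ) : ℝ) a b m = 1 := by
  rw [hahnQ, Finset.sum_range_succ', Finset.sum_eq_zero]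
  · simp [poch_zero]
  · intro k _
    rw [poch_succ_left (-((0 : ℕ) : ℝ))]
    simp

lemma amp {m j : ℕ} (h : j ≤ m) (α β : ℝ) (hα : α > -1) (hβ : β > 0) :
    hahnQt j m (α + 1) (β - 1) m * hahnQt j 0 α β m
      = Real.sqrt (poch β (m + 1) * poch (α + 1) (m + 1)) *
        ((2 * (j : ℝ) + α + β + 1) * poch (-(m : ℝ)) j
          / (poch ((j : ℝ) + α + β + 1) (m + 1) * (j.factorial : ℝ))
          / Real.sqrt ((α + j + 1) * (β + j))) := by
  have hα1 : 0 < α + 1 := by linarith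
  have hj0 : (0 : ℝ) ≤ j := by positivity
  have hS : 0 < poch ((j : ℝ) + α + β + 1) (m + 1) := poch_pos (by linarith) _
  have hD : 0 < 2 * (j : ℝ) + α + β + 1 := by linarith
  have hA1 : 0 < poch (α + 1) j := poch_pos hα1 _
  have hA2 : 0 < poch (α + 1 + 1) j := poch_pos (by linarith) _
  have hB1 : 0 < poch β j := poch_pos hβ _
  have hB2 : 0 < poch (β + 1) j := poch_pos (by linarith) _
  have hAm : 0 < poch (α + 1 + 1) m := poch_pos (by linarith) _
  have hBm : 0 < poch (β + 1) m := poch_pos (by linarith) _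
  have eA : poch (α + 1) j * (α + 1 + j) = (α + 1) * poch (α + 1 + 1) j := by
    rw [← poch_succ, poch_succ_left]
  have eB : poch β j * (β + j) = β * poch (β + 1) j := by
    rw [← poch_succ, poch_succ_left]
  have hf : (0 : ℝ) < j.factorial := by positivity
  have hfm : (0 : ℝ) < m.factorial := by positivity
  obtain ⟨P, hP, eP⟩ : ∃ P : ℝ, 0 < P ∧ poch (-(m : ℝ)) j = (-1) ^ j * P :=
    ⟨(m.choose j : ℝ) * (j.factorial : ℝ), by have := Nat.choose_pos h; positivity,
      by rw [poch_neg]; ring⟩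
  have hs : ((-1 : ℝ) ^ j) ≠ 0 := by positivity
  have hs2 : ((-1 : ℝ) ^ j) * (-1) ^ j = 1 := by rw [← mul_pow]; simp
  have H1 : hahnH j (α + 1) (β - 1) m
      = poch ((j : ℝ) + α + β + 1) (m + 1) * (j.factorial : ℝ)
        / ((2 * (j : ℝ) + α + β + 1) * P * m.factorial) * (poch β j / poch (α + 1 + 1) j) := by
    rw [hahnH, eP, show (j : ℝ) + (α + 1) + (β - 1) + 1 = (j : ℝ) + α + β + 1 by ring,
      show 2 * (j : ℝ) + (α + 1) + (β - 1) + 1 = 2 * (j : ℝ) + α + β + 1 by ring,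
      show β - 1 + 1 = β by ring]
    field_simp
  have H2 : hahnH j α β m
      = poch ((j : ℝ) + α + β + 1) (m + 1) * (j.factorial : ℝ)
        / ((2 * (j : ℝ) + α + β + 1) * P * m.factorial) * (poch (β + 1) j / poch (α + 1) j) := by
    rw [hahnH, eP]
    field_simp
  have W1 : hahnW m (α + 1) (β - 1) m = poch (α + 1 + 1) m / m.factorial := by
    simp [hahnW, poch_zero]
  have W2 : hahnW 0 α β m = poch (β + 1) m / m.factorial := by
    simp [hahnW, poch_zero]
  have hH1 : 0 < hahnH j (α + 1) (β - 1) m := by rw [H1]; positivity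
  have hH2 : 0 < hahnH j α β m := by rw [H2]; positivity
  have hW1 : 0 < hahnW m (α + 1) (β - 1) m := by rw [W1]; positivity
  have hW2 : 0 < hahnW 0 α β m := by rw [W2]; positivity
  have hAj : 0 < α + j + 1 := by linarith
  have hBj : 0 < β + j := by linarith
  rw [hahnQt, hahnQt, hahnQ_zero, hahnQ_last h _ _ (by linarith), show β - 1 + 1 = β by ring]
  have key : Real.sqrt (hahnW m (α + 1) (β - 1) m) * Real.sqrt (hahnW 0 α β m)
      / (Real.sqrt (hahnH j (α + 1) (β - 1) m) * Real.sqrt (hahnH j α β m))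
      = Real.sqrt (poch β (m + 1) * poch (α + 1) (m + 1)) / Real.sqrt ((α + j + 1) * (β + j))
        * ((2 * (j : ℝ) + α + β + 1) * P
          / (poch ((j : ℝ) + α + β + 1) (m + 1) * (j.factorial : ℝ))
          * (poch (α + 1 + 1) j / poch β j)) := by
    rw [← Real.sqrt_mul hW1.le, ← Real.sqrt_mul hH1.le, ← Real.sqrt_div (by positivity),
      ← Real.sqrt_div (by rw [poch_succ_left, poch_succ_left]; positivity)]
    rw [Real.sqrt_eq_iff_mul_self_eq (by positivity) (by positivity), mul_mul_mul_comm,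
      Real.mul_self_sqrt (by rw [poch_succ_left, poch_succ_left]; positivity),
      W1, W2, H1, H2, poch_succ_left β m, poch_succ_left (α + 1) m]
    have eA' : poch (α + 1) j = (α + 1) * poch (α + 1 + 1) j / (α + j + 1) := by
      rw [← eA]; field_simp; ring
    have eB' : poch (β + 1) j = poch β j * (β + j) / β := by
      rw [eB]; field_simp
    rw [eA', eB']
    field_simp
  calc _ = ((-1) ^ j * poch β j / poch (α + 1 + 1) j) * (Real.sqrt (hahnW m (α + 1) (β - 1) m)
      * Real.sqrt (hahnW 0 α β m)
      / (Real.sqrt (hahnH j (α + 1) (β - 1) m) * Real.sqrt (hahnH j α β m))) := by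
        have := Real.sqrt_pos.2 hH1
        have := Real.sqrt_pos.2 hH2
        field_simp
    _ = _ := by
        rw [key, eP]
        have := Real.sqrt_pos.2 (mul_pos hAj hBj)
        field_simp

theorem hahn_end_to_end_correlation (m : ℕ) (α β : ℝ) (hα : α > -1) (hβ : β > 0) (t : ℝ) :
    hahnCorr α β m ⟨2 * m + 1, by omega⟩ ⟨0, by omega⟩ t
      = -Complex.I * (-1 : ℂ) ^ m
          * (Real.sqrt (poch β (m + 1) * poch (α + 1) (m + 1)) : ℝ)
          * ((∑ j ∈ Finset.range (m + 1),
              ((2 * (j : ℝ) + α + β + 1) * poch (-(m : ℝ)) j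
                  / (poch ((j : ℝ) + α + β + 1) (m + 1) * (j.factorial : ℝ)))
                * (Real.sin (2 * t * Real.sqrt ((α + j + 1) * (β + j)))
                    / Real.sqrt ((α + j + 1) * (β + j))) : ℝ) : ℂ) := by
  set F : ℕ → ℂ := fun j => ((hahnQt j m (α + 1) (β - 1) m * hahnQt j 0 α β m : ℝ) : ℂ) with hF
  set w : ℕ → ℝ := fun j => Real.sqrt ((α + j + 1) * (β + j)) with hw
  set G : ℕ → ℂ := fun c => if c ≤ m then
      -((-1 : ℂ) ^ m / 2) * F (m - c) * Complex.exp (Complex.I * ((2 * t * w (m - c) : ℝ) : ℂ))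
    else ((-1 : ℂ) ^ m / 2) * F (c - m - 1)
      * Complex.exp (-Complex.I * ((2 * t * w (c - m - 1) : ℝ) : ℂ)) with hG
  have h2 : (Real.sqrt 2) * Real.sqrt 2 = 2 := Real.mul_self_sqrt (by norm_num)
  have step1 : hahnCorr α β m ⟨2 * m + 1, by omega⟩ ⟨0, by omega⟩ t
      = ∑ c : Fin (2 * m + 2), G c := by
    rw [hahnCorr]
    refine Finset.sum_congr rfl fun c _ => ?_
    have e1 : (2 * m + 1) / 2 = m := by omega
    have e2 : (2 * m + 1) % 2 = 1 := by omega
    have e3 : ∀ s x y : ℝ, s * ((-1) ^ m / Real.sqrt 2) * x * ((-1) ^ 0 / Real.sqrt 2 * y)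
        = s * ((-1) ^ m / 2) * (x * y) := by
      intro s x y
      rw [← h2]
      field_simp
      simp
    simp only [hahnU, Matrix.of_apply, e1, e2, hahnEps, hG, hF, hw]
    by_cases hc : (c : ℕ) ≤ m
    · simp only [hc, if_true, Nat.zero_mod, Nat.zero_div, one_ne_zero, if_false]
      rw [e3]
      push_cast
      congr 1
      · ring
      · congr 1; ring
    · simp only [hc, if_true, Nat.zero_mod, Nat.zero_div, one_ne_zero, if_false]
      rw [e3]
      push_cast
      congr 1
      · ring
      · congr 1; ring
  rw [step1, Fin.sum_univ_eq_sum_range, show 2 * m + 2 = (m + 1) + (m + 1) by ring,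
    Finset.sum_range_add, ← Finset.sum_range_reflect, ← Finset.sum_add_distrib,
    Complex.ofReal_sum, Finset.mul_sum]
  refine Finset.sum_congr rfl fun j hj => ?_
  have hj' : j ≤ m := by have := Finset.mem_range.1 hj; omega
  have g1 : G (m + 1 - 1 - j) = -((-1 : ℂ) ^ m / 2) * F j
      * Complex.exp (Complex.I * ((2 * t * w j : ℝ) : ℂ)) := by
    simp only [hG]
    rw [if_pos (by omega), show m - (m + 1 - 1 - j) = j by omega]
  have g2 : G (m + 1 + j) = ((-1 : ℂ) ^ m / 2) * F j
      * Complex.exp (-Complex.I * ((2 * t * w j : ℝ) : ℂ)) := by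
    simp only [hG]
    rw [if_neg (by omega), show m + 1 + j - m - 1 = j by omega]
  rw [g1, g2]
  have hsin : Complex.exp (-Complex.I * ((2 * t * w j : ℝ) : ℂ))
      - Complex.exp (Complex.I * ((2 * t * w j : ℝ) : ℂ))
      = -2 * Complex.I * ((Real.sin (2 * t * w j) : ℝ) : ℂ) := by
    rw [Complex.ofReal_sin, Complex.sin, neg_mul, mul_comm Complex.I]
    simp only [neg_mul]
    linear_combination (Complex.exp (-(((2 * t * w j : ℝ) : ℂ) * Complex.I))
      - Complex.exp (((2 * t * w j : ℝ) : ℂ) * Complex.I)) * Complex.I_sq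
  have hFj : F j = _ := congrArg (fun x : ℝ => (x : ℂ)) (amp hj' α β hα hβ)
  have hfin : ∀ x : ℝ, (x / w j : ℝ) * (Real.sin (2 * t * w j)) = x * (Real.sin (2 * t * w j) / w j) :=
    fun x => by ring
  rw [← hfin]
  rw [Complex.ofReal_mul] at hFj
  rw [Complex.ofReal_mul (_ / w j)]
  linear_combination ((-1 : ℂ) ^ m / 2) * F j * hsin
    - Complex.I * (-1 : ℂ) ^ m * ((Real.sin (2 * t * w j) : ℝ) : ℂ) * hFj
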